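/- Let M be a right R-module with a chain 0 = M⁽⁰⁾ ≤ M⁽¹⁾ ≤ ... ≤ M⁽ⁿ⁾ = M such that each factor End(M⁽ⁱ⁾/M⁽ⁱ⁻¹⁾) is a semilocal ring. Then the ring E_M of chain-preserving endomorphisms of M is semilocal, and codim(E_M) ≤ Σᵢ codim(End(M⁽ⁱ⁾/M⁽ⁱ⁻¹⁾)). -/

import Mathlib

universe u

section Chains

variable {R : Type u} [Ring R]

/-- The `i`-th factor module `M⁽ⁱ⁺¹⁾/M⁽ⁱ⁾` of a chain of submodules
`c : Fin (n+1) → Submodule R M`. -/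
abbrev ChainFactor {M : Type u} [AddCommGroup M] [Module R M] {n : ℕ}
    (c : Fin (n + 1) → Submodule R M) (i : Fin n) : Type u :=
  c i.succ ⧸ (Submodule.comap (c i.succ).subtype (c i.castSucc))

/-- A linear map `f : M → N` preserves the chains `c`, `d` if `f(c i) ⊆ d i` for all `i`. -/
def PreservesChain {M N : Type u} [AddCommGroup M] [Module R M] [AddCommGroup N]
    [Module R N] {n : ℕ} (f : M →ₗ[R] N) (c : Fin (n + 1) → Submodule R M)
    (d : Fin (n + 1) → Submodule R N) : Prop :=
  ∀ i, ∀ x ∈ c i, f x ∈ d i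

/-- The linear map induced on the `i`-th factor modules by a chain-preserving map. -/
def inducedHom {M N : Type u} [AddCommGroup M] [Module R M] [AddCommGroup N]
    [Module R N] {n : ℕ} {c : Fin (n + 1) → Submodule R M}
    {d : Fin (n + 1) → Submodule R N} (f : M →ₗ[R] N) (hf : PreservesChain f c d)
    (i : Fin n) : ChainFactor c i →ₗ[R] ChainFactor d i :=
  Submodule.mapQ _ _ (f.restrict fun x hx => hf i.succ x hx)
    (fun x hx => hf i.castSucc x hx)

/-- The ring `E_M` of chain-preserving endomorphisms of `M`, as a subring of
`End(M)`. -/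
def ChainEnd {M : Type u} [AddCommGroup M] [Module R M] {n : ℕ}
    (c : Fin (n + 1) → Submodule R M) : Subring (Module.End R M) where
  carrier := {f | ∀ i, ∀ x ∈ c i, f x ∈ c i}
  zero_mem' := by intro i x hx; simp
  one_mem' := by intro i x hx; simpa using hx
  add_mem' := by intro f g hf hg i x hx; simpa using (c i).add_mem (hf i x hx) (hg i x hx)
  neg_mem' := by intro f hf i x hx; simpa using (c i).neg_mem (hf i x hx)
  mul_mem' := by intro f g hf hg i x hx; exact hf i _ (hg i x hx)

/-- The canonical map from `E_M` to the product of the endomorphism rings of the factor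
modules, sending a chain endomorphism to the tuple of its induced endomorphisms. -/
def chainDiag {M : Type u} [AddCommGroup M] [Module R M] {n : ℕ}
    (c : Fin (n + 1) → Submodule R M) (f : ChainEnd c) (i : Fin n) :
    Module.End R (ChainFactor c i) :=
  inducedHom (f : Module.End R M) (fun j x hx => f.2 j x hx) i

end Chains

/-- A submodule `N ≤ M` is superfluous (small) if `N ⊔ K = ⊤` implies `K = ⊤`. -/
def IsSuperfluous {R M : Type*} [Ring R] [AddCommGroup M] [Module R M]
    (N : Submodule R M) : Prop :=
  ∀ K : Submodule R M, N ⊔ K = ⊤ → K = ⊤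

/-- The dual Goldie dimension of a ring `R`. -/
noncomputable def dualGoldieDim (R : Type u) [Ring R] : ℕ∞ :=
  sSup {e : ℕ∞ | ∃ (m : ℕ) (N : Fin m → Type u) (_ : ∀ i, AddCommGroup (N i))
    (_ : ∀ i, Module R (N i)) (f : R →ₗ[R] ∀ i, N i),
    e = (m : ℕ∞) ∧ (∀ i, Nontrivial (N i)) ∧ Function.Surjective f ∧
      IsSuperfluous (LinearMap.ker f)}

/-- A ring `R` is semilocal if `R/J(R)` is semisimple artinian. -/
def IsSemilocalRing (R : Type u) [Ring R] : Prop :=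
  ∃ (T : Type u) (_ : Ring T) (_ : IsSemisimpleRing T) (π : R →+* T),
    Function.Surjective π ∧
      (RingHom.ker π : Set R) = ((⊥ : Ideal R).jacobson : Set R)

section RankFunction

variable {A : Type u} [Ring A] {N : ℕ} (d : A → ℕ)

/-- A ring with a bounded function that is superadditive along `a ↦ a * (1 - b * a)` and
vanishes only at units is semilocal. -/
theorem isSemilocalRing_of_rank (hbound : ∀ a, d a ≤ N)
    (hadd : ∀ a b, d a + d (1 - b * a) ≤ d (a * (1 - b * a)))
    (hunit : ∀ a, d a = 0 → IsUnit a) : IsSemilocalRing A := by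
  refine ⟨A ⧸ Ring.jacobson A, inferInstance, ?_, Ideal.Quotient.mk _,
    Ideal.Quotient.mk_surjective, ?_⟩
  · rw [IsSemisimpleRing, isSemisimpleModule_iff]
    refine ⟨fun I => ?_⟩
    let q := Ideal.Quotient.mk (Ring.jacobson A)
    obtain ⟨a, ha, hmax⟩ : ∃ a, q (1 - a) ∈ I ∧ ∀ a', q (1 - a') ∈ I → d a' ≤ d a := by
      have hfin : (d '' {a | q (1 - a) ∈ I}).Finite :=
        (Set.finite_Iic N).subset (by rintro _ ⟨a, -, rfl⟩; exact hbound a)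
      obtain ⟨_, ⟨⟨a, ha, rfl⟩, hmax⟩⟩ := hfin.exists_maximal ⟨_, 1, by simp, rfl⟩
      refine ⟨a, ha, fun a' ha' => ?_⟩
      by_contra! h
      exact absurd (hmax ⟨a', ha', rfl⟩ h.le) (not_le.mpr h)
    refine ⟨Ideal.span {q a}, ?_, ?_⟩
    · rw [disjoint_iff, eq_bot_iff]
      rintro x ⟨hxI, hxa⟩
      obtain ⟨r, rfl⟩ := Ideal.mem_span_singleton'.mp hxa
      obtain ⟨r, rfl⟩ := Ideal.Quotient.mk_surjective r
      have hu : ∀ b, IsUnit (1 - b * (r * a)) := fun b => by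
        have h1 := hadd a (b * r)
        have h2 : q (1 - a * (1 - b * r * a)) ∈ I := by
          have : 1 - a * (1 - b * r * a) = (1 - a) + a * b * (r * a) := by noncomm_ring
          rw [this, map_add, map_mul q (a * b)]
          refine I.add_mem ha (Submodule.smul_mem I _ hxI)
        have h3 := hmax _ h2
        rw [← mul_assoc]
        exact hunit _ (by omega)
      change q r * q a = 0
      rw [← map_mul]
      refine Ideal.Quotient.eq_zero_iff_mem.mpr ?_
      rw [← Ideal.jacobson_bot]
      refine Ideal.mem_jacobson_iff.mpr fun y => ?_
      obtain ⟨z, hz⟩ := (hu (-y)).exists_left_inv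
      refine ⟨z, ?_⟩
      rw [Ideal.mem_bot, ← sub_eq_zero.mpr hz]
      noncomm_ring
    · rw [codisjoint_iff, Ideal.eq_top_iff_one]
      have : (1 : A ⧸ Ring.jacobson A) = q (1 - a) + q a := by rw [← map_add]; simp
      rw [this]
      exact Submodule.add_mem_sup ha (Ideal.mem_span_singleton_self _)
  · rw [Ideal.mk_ker, Ideal.jacobson_bot]

/-- A bounded rank function as in `isSemilocalRing_of_rank` bounds the dual Goldie dimension. -/
theorem dualGoldieDim_le_of_rank (hbound : ∀ a, d a ≤ N)
    (hadd : ∀ a b, d a + d (1 - b * a) ≤ d (a * (1 - b * a)))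
    (hunit : ∀ a, d a = 0 → IsUnit a) : dualGoldieDim A ≤ N := by
  refine sSup_le ?_
  rintro _ ⟨m, P, _, _, f, rfl, hnt, hf, -⟩
  suffices h : ∀ k ≤ m, ∃ a, k ≤ d a ∧ ∀ j : Fin m, k ≤ j → f a j = f 1 j by
    obtain ⟨a, ha, -⟩ := h m le_rfl
    exact_mod_cast ha.trans (hbound a)
  intro k
  induction k with
  | zero => exact fun _ => ⟨1, Nat.zero_le _, fun _ _ => rfl⟩
  | succ k ih =>
    intro hk
    obtain ⟨a, hka, ha⟩ := ih (by omega)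
    let i : Fin m := ⟨k, by omega⟩
    obtain ⟨e, he⟩ := hf (Pi.single i (f 1 i))
    have hmul : ∀ (x y : A) (j : Fin m), f (x * y) j = x • f y j := fun x y j => by
      rw [← smul_eq_mul, map_smul, Pi.smul_apply]
    have hone : ∀ (x : A) (j : Fin m), x • f 1 j = f x j := fun x j => by
      rw [← hmul, mul_one]
    refine ⟨a * (1 - e * a), ?_, fun j hj => ?_⟩
    · have hpos : d (1 - e * a) ≠ 0 := fun h0 => by
        have h1 : f (1 - e * a) i = 0 := by
          rw [map_sub, Pi.sub_apply, hmul, ha i le_rfl, hone, he, Pi.single_eq_same, sub_self]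
        obtain ⟨v, hv⟩ := (hunit _ h0).exists_left_inv
        have h2 : f 1 i = 0 := by rw [← hv, hmul, h1, smul_zero]
        obtain ⟨x, hx⟩ := exists_ne (0 : P i)
        obtain ⟨y, hy⟩ := hf (Pi.single i x)
        apply hx
        rw [← Pi.single_eq_same (M := P) i x, ← hy, ← hone, h2, smul_zero]
      have := hadd a e
      omega
    · have hne : j ≠ i := fun h => by
        subst h
        exact absurd hj (by simp [i])
      have haj := ha j (by omega)
      rw [hmul, map_sub, Pi.sub_apply, hmul, haj, hone, he, Pi.single_eq_of_ne hne, sub_zero,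
        hone, haj]

end RankFunction

section Semisimple

variable {T : Type u} [Ring T]

/-- The corank `length (T / T t)` of an element of a ring is additive along
`t ↦ t * (1 - b * t)`. -/
theorem length_quotient_span_mul (t b : T) :
    Module.length T (T ⧸ Ideal.span {t * (1 - b * t)}) =
      Module.length T (T ⧸ Ideal.span {t}) + Module.length T (T ⧸ Ideal.span {1 - b * t}) := by
  set u := 1 - b * t with hu
  have hle : Ideal.span {t * u} ≤ Ideal.span {u} :=
    Ideal.span_le.mpr (by simpa using Ideal.mul_mem_left _ t (Ideal.mem_span_singleton_self u))
  have hmap : Ideal.span {t} ≤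
      Submodule.comap (LinearMap.toSpanSingleton T T u) (Ideal.span {t * u}) :=
    Ideal.span_le.mpr (by
      rintro _ rfl
      exact Ideal.mem_span_singleton_self _)
  refine Module.length_eq_add_of_exact
    (Submodule.mapQ _ _ (LinearMap.toSpanSingleton T T u) hmap)
    (Submodule.factor hle) ?_ (Submodule.factor_surjective hle) ?_
  · rw [← LinearMap.ker_eq_bot, Submodule.ker_mapQ, ← Submodule.mkQ_map_self (Ideal.span {t})]
    congr 1
    refine le_antisymm (fun x hx => ?_) hmap
    obtain ⟨r, hr⟩ := Ideal.mem_span_singleton'.mp hx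
    have hr : r * (t * u) = x * u := hr
    refine Ideal.mem_span_singleton'.mpr ⟨r + (x - r * t) * b, ?_⟩
    have h0 : (x - r * t) * u = 0 := by rw [sub_mul, ← hr]; noncomm_ring
    have h1 : (x - r * t) * u = (x - r * t) - (x - r * t) * b * t := by rw [hu]; noncomm_ring
    rw [add_mul, ← sub_eq_zero.mp (h1.symm.trans h0)]
    abel
  · rw [LinearMap.exact_iff, Submodule.range_mapQ, Submodule.ker_mapQ,
      Submodule.comap_id, LinearMap.range_toSpanSingleton]

variable [IsSemisimpleRing T]

theorem isUnit_of_length_quotient_span_eq_zero {t : T}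
    (h : Module.length T (T ⧸ Ideal.span {t}) = 0) : IsUnit t := by
  rw [Module.length_eq_zero_iff, Submodule.Quotient.subsingleton_iff] at h
  obtain ⟨s, hs⟩ := Ideal.mem_span_singleton'.mp (h.symm ▸ Submodule.mem_top : (1 : T) ∈ _)
  exact IsUnit.of_mul_eq_one_right s hs

end Semisimple

section JacobsonQuotient

variable {S T : Type u} [Ring S] [Ring T] {π : S →+* T}

theorem isUnit_of_map_eq_one (hker : (RingHom.ker π : Set S) = ((⊥ : Ideal S).jacobson : Set S))
    {z : S} (hz : π z = 1) : IsUnit z := by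
  have key : ∀ x, π x = 1 → ∃ s, s * x = 1 := fun x hx => by
    have : x - 1 ∈ (⊥ : Ideal S).jacobson := by
      rw [← SetLike.mem_coe, ← hker]
      simp [hx]
    obtain ⟨s, hs⟩ := Ideal.exists_mul_sub_mem_of_sub_one_mem_jacobson x this
    exact ⟨s, sub_eq_zero.mp hs⟩
  obtain ⟨s, hs⟩ := key z hz
  have hπs : π s = 1 := by rw [← mul_one (π s), ← hz, ← map_mul, hs, map_one, hz]
  obtain ⟨s', hs'⟩ := key s hπs
  rw [left_inv_eq_right_inv hs' hs] at hs'
  exact ⟨⟨z, s, hs', hs⟩, rfl⟩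

theorem isUnit_of_isUnit_map (hπ : Function.Surjective π)
    (hker : (RingHom.ker π : Set S) = ((⊥ : Ideal S).jacobson : Set S))
    {x : S} (hx : IsUnit (π x)) : IsUnit x := by
  obtain ⟨v, hxv, hvx⟩ := isUnit_iff_exists.mp hx
  obtain ⟨y, rfl⟩ := hπ v
  have h1 : IsUnit (x * y) := isUnit_of_map_eq_one hker (by rw [map_mul, hxv])
  have h2 : IsUnit (y * x) := isUnit_of_map_eq_one hker (by rw [map_mul, hvx])
  obtain ⟨r, hr⟩ := h1.exists_right_inv
  obtain ⟨l, hl⟩ := h2.exists_left_inv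
  rw [mul_assoc] at hr
  rw [← mul_assoc] at hl
  have := left_inv_eq_right_inv hl hr
  rw [this] at hl
  exact ⟨⟨x, y * r, hr, hl⟩, rfl⟩

theorem length_le_dualGoldieDim [IsSemisimpleRing T] (hπ : Function.Surjective π)
    (hker : (RingHom.ker π : Set S) = ((⊥ : Ideal S).jacobson : Set S)) :
    Module.length T T ≤ dualGoldieDim S := by
  obtain ⟨m, P, e, hP⟩ := IsSemisimpleModule.exists_linearEquiv_fin_dfinsupp T T
  let e' : T ≃ₗ[T] (∀ i, P i) := e.trans DFinsupp.linearEquivFunOnFintype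
  have hlen : Module.length T T = m := by
    rw [e'.length_eq, Module.length_pi_of_fintype]
    simp
  rw [hlen]
  let _ : ∀ i, Module S (P i) := fun i => Module.compHom (P i) π
  let f : S →ₗ[S] (∀ i, P i) :=
    { toFun := fun s => e' (π s)
      map_add' := fun x y => by simp
      map_smul' := fun x y => by
        rw [smul_eq_mul, map_mul, ← smul_eq_mul, map_smul]
        rfl }
  refine le_sSup ⟨m, fun i => P i, inferInstance, inferInstance, f, rfl,
    fun i => IsSimpleModule.nontrivial T (P i), e'.surjective.comp hπ, fun K hK => ?_⟩
  have h1 : (1 : S) ∈ LinearMap.ker f ⊔ K := hK ▸ Submodule.mem_top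
  obtain ⟨j, hj, k, hk, hjk⟩ := Submodule.mem_sup.mp h1
  have hπj : π j = 0 := e'.map_eq_zero_iff.mp hj
  have hπk : π k = 1 := by rw [← map_one π, ← hjk, map_add, hπj, zero_add]
  exact Ideal.eq_top_of_isUnit_mem K hk (isUnit_of_map_eq_one hker hπk)

end JacobsonQuotient

/-- A ring with a finite family of ring homomorphisms to semisimple rings that jointly reflect
units is semilocal, with dual Goldie dimension at most the sum of the lengths of the targets. -/
theorem isSemilocalRing_of_reflects_isUnit {A : Type u} [Ring A] {ι : Type*} [Fintype ι]
    {T : ι → Type u} [∀ i, Ring (T i)] [∀ i, IsSemisimpleRing (T i)] (φ : ∀ i, A →+* T i)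
    (hφ : ∀ a, (∀ i, IsUnit (φ i a)) → IsUnit a) :
    IsSemilocalRing A ∧ dualGoldieDim A ≤ ∑ i, Module.length (T i) (T i) := by
  let l : ∀ i, A → ℕ := fun i a => (Module.length (T i) (T i ⧸ Ideal.span {φ i a})).toNat
  have hl : ∀ i a, (l i a : ℕ∞) = Module.length (T i) (T i ⧸ Ideal.span {φ i a}) :=
    fun i a => ENat.natCast_toNat Module.length_ne_top
  have hbound : ∀ a, ∑ i, l i a ≤ ∑ i, (Module.length (T i) (T i)).toNat := fun a =>
    Finset.sum_le_sum fun i _ => ENat.toNat_le_toNat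
      (Module.length_le_of_surjective _ (Submodule.mkQ_surjective _)) Module.length_ne_top
  have hadd : ∀ a b, ∑ i, l i a + ∑ i, l i (1 - b * a) ≤ ∑ i, l i (a * (1 - b * a)) := by
    intro a b
    rw [← Finset.sum_add_distrib]
    refine (Finset.sum_congr rfl fun i _ => ?_).le
    have := length_quotient_span_mul (φ i a) (φ i b)
    rw [← map_mul, ← map_one (φ i), ← map_sub, ← map_mul, ← hl, ← hl, ← hl] at this
    exact_mod_cast this.symm
  have hunit : ∀ a, ∑ i, l i a = 0 → IsUnit a := fun a ha => hφ a fun i => by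
    refine isUnit_of_length_quotient_span_eq_zero ?_
    rw [← hl, Finset.sum_eq_zero_iff.mp ha i (Finset.mem_univ i), Nat.cast_zero]
  refine ⟨isSemilocalRing_of_rank _ hbound hadd hunit,
    (dualGoldieDim_le_of_rank _ hbound hadd hunit).trans_eq ?_⟩
  rw [Nat.cast_sum]
  exact Finset.sum_congr rfl fun i _ => ENat.natCast_toNat Module.length_ne_top

section ChainEnd

variable {R : Type u} [Ring R] {M : Type u} [AddCommGroup M] [Module R M] {n : ℕ}
  (c : Fin (n + 1) → Submodule R M)

/-- The `i`-th component of `chainDiag` as a ring homomorphism. -/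
def chainDiagHom (i : Fin n) : ChainEnd c →+* Module.End R (ChainFactor c i) where
  toFun f := chainDiag c f i
  map_zero' := by ext x; rfl
  map_one' := by ext x; rfl
  map_add' f g := by ext x; rfl
  map_mul' f g := by ext x; rfl

theorem isUnit_of_isUnit_chainDiag (h0 : c 0 = ⊥) (hn : c (Fin.last n) = ⊤) (hmono : Monotone c)
    (f : ChainEnd c) (hf : ∀ i, IsUnit (chainDiag c f i)) : IsUnit f := by
  have hmk : ∀ i (x : c (Fin.succ i)), chainDiag c f i (Submodule.Quotient.mk x) =
      Submodule.Quotient.mk ⟨f.1 x, f.2 _ x x.2⟩ := fun i x => rfl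
  have hbij : ∀ i, (∀ x ∈ c i, f.1 x = 0 → x = 0) ∧ ∀ y ∈ c i, ∃ x ∈ c i, f.1 x = y := by
    intro i
    induction i using Fin.induction with
    | zero =>
      rw [h0]
      refine ⟨fun x hx _ => hx, fun y hy => ⟨0, Submodule.zero_mem _, ?_⟩⟩
      rw [map_zero, (Submodule.mem_bot R).mp hy]
    | succ i ih =>
      have hb := (Module.End.isUnit_iff _).mp (hf i)
      have hle : c i.castSucc ≤ c i.succ := hmono i.castSucc_le_succ
      refine ⟨fun x hx hfx => ih.1 x ?_ hfx, fun y hy => ?_⟩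
      · have : (Submodule.Quotient.mk ⟨x, hx⟩ : ChainFactor c i) = 0 := by
          apply hb.1
          rw [hmk, map_zero, Submodule.Quotient.mk_eq_zero, Submodule.mem_comap]
          simp [hfx]
        rwa [Submodule.Quotient.mk_eq_zero] at this
      · obtain ⟨x, hx⟩ := hb.2 (Submodule.Quotient.mk ⟨y, hy⟩)
        obtain ⟨x, rfl⟩ := Submodule.Quotient.mk_surjective _ x
        rw [hmk, Submodule.Quotient.eq] at hx
        obtain ⟨z, hz, hfz⟩ := ih.2 _ hx
        refine ⟨x - z, Submodule.sub_mem _ x.2 (hle hz), ?_⟩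
        rw [map_sub, hfz]
        simp
  have hlast := hbij (Fin.last n)
  rw [hn] at hlast
  have hinj : Function.Injective f.1 := (injective_iff_map_eq_zero f.1).mpr fun x =>
    hlast.1 x Submodule.mem_top
  have hsurj : Function.Surjective f.1 := fun y =>
    let ⟨x, _, hx⟩ := hlast.2 y Submodule.mem_top
    ⟨x, hx⟩
  let e := LinearEquiv.ofBijective f.1 ⟨hinj, hsurj⟩
  have he : ∀ x, e x = f.1 x := fun _ => rfl
  let g : ChainEnd c := ⟨e.symm.toLinearMap, fun i y hy => by
    obtain ⟨x, hx, rfl⟩ := (hbij i).2 y hy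
    rw [← he]
    simpa using hx⟩
  refine ⟨⟨f, g, ?_, ?_⟩, rfl⟩
  · ext x
    exact e.apply_symm_apply x
  · ext x
    exact e.symm_apply_apply x

end ChainEnd

/-- If `M` has a chain of submodules `0 = c 0 ≤ ... ≤ c n = M` whose factor modules all
have semilocal endomorphism rings, then the ring `E_M` of chain-preserving endomorphisms
is semilocal, and its dual Goldie dimension is bounded by the sum of the dual Goldie
dimensions of the endomorphism rings of the factors. -/
theorem chainEnd_isSemilocal
    {R : Type u} [Ring R] {M : Type u} [AddCommGroup M] [Module R M] {n : ℕ}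
    (c : Fin (n + 1) → Submodule R M) (hmono : Monotone c)
    (h0 : c 0 = ⊥) (hn : c (Fin.last n) = ⊤)
    (hsemi : ∀ i : Fin n, IsSemilocalRing (Module.End R (ChainFactor c i))) :
    IsSemilocalRing (ChainEnd c) ∧
      dualGoldieDim (ChainEnd c) ≤
        ∑ i : Fin n, dualGoldieDim (Module.End R (ChainFactor c i)) := by
  choose T _ _ π hπ hker using hsemi
  obtain ⟨hA, hdim⟩ := isSemilocalRing_of_reflects_isUnit
    (fun i => (π i).comp (chainDiagHom c i)) fun f hf =>
      isUnit_of_isUnit_chainDiag c h0 hn hmono f fun i =>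
        isUnit_of_isUnit_map (hπ i) (hker i) (hf i)
  exact ⟨hA, hdim.trans (Finset.sum_le_sum fun i _ => length_le_dualGoldieDim (hπ i) (hker i))⟩
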